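/- arXiv:math/0610982 — 2 statements merged into one kernel-verified Lean document; each statement's English description precedes it below -/
import Mathlib

section
/- Let k be a field of characteristic p, where p > 3 is prime, let G be a group, let α₁ : G → k satisfy α₁(gh) = α₁(g) + α₁(h) for all g, h ∈ G, and let α₂ : G → k satisfy α₂(gh) = α₂(g) + α₂(h) + 2α₁(g)α₁(h) for all g, h ∈ G. Let ρ : G → GL(k³) be the representation with ρ(g)(e₁) = e₁ + α₁(g)e₂ + α₂(g)e₃, ρ(g)(e₂) = e₂ + 2α₁(g)e₃, ρ(g)(e₃) = e₃. If α₁ is not identically zero, then the k-linear span of the set {ρ(g)v − v : g ∈ G, v ∈ k³} equals the 2-dimensional subspace spanned by e₂ and e₃. -/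
/-- With `k`, `G`, `α₁`, `α₂`, `ρ` as in Statement 1 (characteristic
`p > 3`, `α₁` additive, `α₂(gh) = α₂(g) + α₂(h) + 2α₁(g)α₁(h)`, `ρ g` the matrix
`!![1,0,0; α₁ g,1,0; α₂ g, 2α₁ g,1]` acting by `mulVec`), if `α₁` is not identically
zero then the `k`-linear span of `{ρ(g)v − v : g ∈ G, v ∈ k³}` equals the
`2`-dimensional subspace spanned by `e₂ = ![0,1,0]` and `e₃ = ![0,0,1]`. -/
theorem stmt2 (k : Type*) [Field k] (p : ℕ) (hp : p.Prime) (hp3 : 3 < p) [CharP k p]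
    (G : Type*) [Group G] (α₁ α₂ : G → k)
    (hα₁ : ∀ g h : G, α₁ (g * h) = α₁ g + α₁ h)
    (hα₂ : ∀ g h : G, α₂ (g * h) = α₂ g + α₂ h + 2 * α₁ g * α₁ h)
    (ρ : G →* GL (Fin 3) k)
    (hρ : ∀ g : G, (ρ g : Matrix (Fin 3) (Fin 3) k) =
      !![1, 0, 0; α₁ g, 1, 0; α₂ g, 2 * α₁ g, 1])
    (hα₁ne : ∃ g : G, α₁ g ≠ 0) :
    Submodule.span k
        {w : Fin 3 → k | ∃ (g : G) (v : Fin 3 → k),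
          (ρ g : Matrix (Fin 3) (Fin 3) k).mulVec v - v = w}
      = Submodule.span k ({![0, 1, 0], ![0, 0, 1]} : Set (Fin 3 → k)) ∧
    Module.finrank k
        ↥(Submodule.span k ({![0, 1, 0], ![0, 0, 1]} : Set (Fin 3 → k))) = 2 := by
  have h2 : (2 : k) ≠ 0 := by
    intro h
    have h' : ((2 : ℕ) : k) = 0 := by exact_mod_cast h
    rw [CharP.cast_eq_zero_iff k p 2] at h'
    have := Nat.le_of_dvd (by norm_num) h'
    omega
  obtain ⟨g₀, hg₀⟩ := hα₁ne
  refine ⟨le_antisymm ?_ ?_, ?_⟩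
  · rw [Submodule.span_le]
    rintro w ⟨g, v, rfl⟩
    rw [SetLike.mem_coe, Submodule.mem_span_pair]
    refine ⟨α₁ g * v 0, α₂ g * v 0 + 2 * α₁ g * v 1, ?_⟩
    rw [hρ]
    ext i
    fin_cases i <;> simp [Matrix.mulVec, dotProduct, Fin.sum_univ_three]
  · rw [Submodule.span_le]
    rintro w (rfl | rfl)
    · apply Submodule.subset_span
      refine ⟨g₀, ![(α₁ g₀)⁻¹, -(α₂ g₀ * (α₁ g₀)⁻¹) / (2 * α₁ g₀), 0], ?_⟩
      rw [hρ]
      ext i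
      fin_cases i <;> simp [Matrix.mulVec, dotProduct, Fin.sum_univ_three, hg₀]
      field_simp
      ring
    · apply Submodule.subset_span
      refine ⟨g₀, ![0, (2 * α₁ g₀)⁻¹, 0], ?_⟩
      rw [hρ]
      ext i
      fin_cases i <;> simp [Matrix.mulVec, dotProduct, Fin.sum_univ_three]
      field_simp
  · have hli : LinearIndependent k ![(![0, 1, 0] : Fin 3 → k), ![0, 0, 1]] := by
      rw [LinearIndependent.pair_iff]
      intro s t h
      have h1 := congrFun h 1
      have h3 := congrFun h 2
      simp at h1 h3
      exact ⟨h1, h3⟩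
    have := finrank_span_eq_card hli
    rw [Matrix.range_cons, Matrix.range_cons, Matrix.range_empty, Set.union_empty, Set.singleton_union] at this
    simpa using this
end

section
/- Let k be a field of characteristic p, where p > 3 is prime, let G be a group, let α₁ : G → k satisfy α₁(gh) = α₁(g) + α₁(h) for all g, h ∈ G, and let α₂ : G → k satisfy α₂(gh) = α₂(g) + α₂(h) + 2α₁(g)α₁(h) for all g, h ∈ G. Let ρ : G → GL(k³) be the representation with ρ(g)(e₁) = e₁ + α₁(g)e₂ + α₂(g)e₃, ρ(g)(e₂) = e₂ + 2α₁(g)e₃, ρ(g)(e₃) = e₃. If α₁ is not identically zero, then the coinvariant space H₀(G, k³) = k³ / span{ρ(g)v − v : g ∈ G, v ∈ k³} has k-dimension 1. -/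
/-- With `k`, `G`, `α₁`, `α₂`, `ρ` as in Statement 1 (characteristic
`p > 3`, `α₁` additive, `α₂(gh) = α₂(g) + α₂(h) + 2α₁(g)α₁(h)`, `ρ g` the matrix
`!![1,0,0; α₁ g,1,0; α₂ g, 2α₁ g,1]` acting by `mulVec`), if `α₁` is not identically
zero then the coinvariant space
`H₀(G, k³) = k³ / span{ρ(g)v − v : g ∈ G, v ∈ k³}` has `k`-dimension `1`. -/
theorem stmt3 (k : Type*) [Field k] (p : ℕ) (hp : p.Prime) (hp3 : 3 < p) [CharP k p]
    (G : Type*) [Group G] (α₁ α₂ : G → k)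
    (hα₁ : ∀ g h : G, α₁ (g * h) = α₁ g + α₁ h)
    (hα₂ : ∀ g h : G, α₂ (g * h) = α₂ g + α₂ h + 2 * α₁ g * α₁ h)
    (ρ : G →* GL (Fin 3) k)
    (hρ : ∀ g : G, (ρ g : Matrix (Fin 3) (Fin 3) k) =
      !![1, 0, 0; α₁ g, 1, 0; α₂ g, 2 * α₁ g, 1])
    (hα₁ne : ∃ g : G, α₁ g ≠ 0) :
    Module.finrank k
      ((Fin 3 → k) ⧸ Submodule.span k
        {w : Fin 3 → k | ∃ (g : G) (v : Fin 3 → k),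
          (ρ g : Matrix (Fin 3) (Fin 3) k).mulVec v - v = w}) = 1 := by
  have h2 : (2 : k) ≠ 0 := by
    intro h
    have h' : ((2 : ℕ) : k) = 0 := by exact_mod_cast h
    rw [CharP.cast_eq_zero_iff k p] at h'
    have := Nat.le_of_dvd (by norm_num) h'
    omega
  obtain ⟨g, hg⟩ := hα₁ne
  have key : Submodule.span k
        {w : Fin 3 → k | ∃ (g : G) (v : Fin 3 → k),
          (ρ g : Matrix (Fin 3) (Fin 3) k).mulVec v - v = w} =
      LinearMap.ker (LinearMap.proj 0 : (Fin 3 → k) →ₗ[k] k) := by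
    apply le_antisymm
    · rw [Submodule.span_le]
      rintro w ⟨g, v, rfl⟩
      simp [hρ, dotProduct, Fin.sum_univ_three, Matrix.vecHead]
    · intro w hw
      have hw0 : w 0 = 0 := by simpa using hw
      apply Submodule.subset_span
      refine ⟨g, ![w 1 / α₁ g, (w 2 - α₂ g * (w 1 / α₁ g)) / (2 * α₁ g), 0], ?_⟩
      ext i
      fin_cases i
      · simp [hρ, dotProduct, Fin.sum_univ_three, hw0]
      · simp [hρ, dotProduct, Fin.sum_univ_three]
        field_simp
      · simp [hρ, dotProduct, Fin.sum_univ_three]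
        field_simp
        ring
  rw [key]
  rw [(LinearMap.quotKerEquivOfSurjective (LinearMap.proj 0 : (Fin 3 → k) →ₗ[k] k)
    (LinearMap.proj_surjective 0)).finrank_eq]
  exact Module.finrank_self k
end
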